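/- arXiv:1602.07837 — 3 statements merged into one kernel-verified Lean document; each statement's English description precedes it below -/
import Mathlib

section
/- (Lemma 4.) Define the n-bracket of the operators L_m recursively: for n = 3, [L_m,L_n,L_k] = p^m q^{m−(n+k)} L_m ∘ [L_n,L_k]_{(q^n p^{−k}, q^k p^{−n})} + p^n q^{n−(k+m)} L_n ∘ [L_k,L_m]_{(q^k p^{−m}, q^m p^{−k})} + p^k q^{k−(m+n)} L_k ∘ [L_m,L_n]_{(q^m p^{−n}, q^n p^{−m})} with [A,B]_{(u,v)} = uAB − vBA; and for n ≥ 4, [L_{i_1},…,L_{i_n}] = Σ_{s=1}^n (−1)^{s+1} (pq)^{x·i_s + y·(i_1+⋯+î_s+⋯+i_n)} L_{i_s} ∘ [L_{i_1},…,L̂_{i_s},…,L_{i_n}], where (x,y) = ((n−1)/2, −1) for odd n and (x,y) = (n/2, 0) for even n (hats denoting omission). Then for every n ≥ 3 there is a sign ε_n ∈ {1,−1}, depending only on n, such that for all integers i_1,…,i_n: [L_{i_1},…,L_{i_n}] = ε_n · (q − p^{−1})^{−(n−1)} · c_n(i_1,…,i_n) · L_{i_1+⋯+i_n} as endomorphisms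 of V. -/
/-- The structure constant `c_n(i_1,…,i_n) = (p q⁻¹)^{⌊(n−1)/2⌋·(i_1+⋯+i_n)} · det M`,
where `M_{r,j} = p^{(r − 2⌊(n−1)/2⌋)·i_j} q^{r·i_j}` for `r = 0,…,n−1`, `j = 1,…,n`. -/
noncomputable def vwC {K : Type*} [Field K] (p q : K) (n : ℕ) (i : Fin n → ℤ) : K :=
  (p * q⁻¹) ^ (((((n - 1) / 2 : ℕ) : ℤ)) * ∑ j, i j) *
    Matrix.det (Matrix.of fun r j : Fin n =>
      p ^ (((r : ℤ) - 2 * (((n - 1) / 2 : ℕ) : ℤ)) * i j) * q ^ ((r : ℤ) * i j))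

/-- The deformed commutator `[A,B]_{(u,v)} = u·A∘B − v·B∘A` of endomorphisms. -/
noncomputable def defComm {K : Type*} [Field K] (u v : K)
    (A B : (ℤ →₀ K) →ₗ[K] (ℤ →₀ K)) : (ℤ →₀ K) →ₗ[K] (ℤ →₀ K) :=
  u • (A ∘ₗ B) - v • (B ∘ₗ A)

/-- The `(p,q)`-deformed 3-bracket `[L_m, L_n, L_k]`. -/
noncomputable def threeBracket {K : Type*} [Field K] (p q : K)
    (L : ℤ → ((ℤ →₀ K) →ₗ[K] (ℤ →₀ K))) (m n k : ℤ) : (ℤ →₀ K) →ₗ[K] (ℤ →₀ K) :=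
  (p ^ m * q ^ (m - (n + k))) •
      (L m ∘ₗ defComm (q ^ n * p ^ (-k)) (q ^ k * p ^ (-n)) (L n) (L k)) +
    (p ^ n * q ^ (n - (k + m))) •
      (L n ∘ₗ defComm (q ^ k * p ^ (-m)) (q ^ m * p ^ (-k)) (L k) (L m)) +
    (p ^ k * q ^ (k - (m + n))) •
      (L k ∘ₗ defComm (q ^ m * p ^ (-n)) (q ^ n * p ^ (-m)) (L m) (L n))

/-- The exponent parameter `x`: `(n−1)/2` for odd `n`, `n/2` for even `n`. -/
def xPar (n : ℕ) : ℤ := if n % 2 = 1 then ((n : ℤ) - 1) / 2 else (n : ℤ) / 2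

/-- The exponent parameter `y`: `−1` for odd `n`, `0` for even `n`. -/
def yPar (n : ℕ) : ℤ := if n % 2 = 1 then -1 else 0

/-- The recursively defined `(p,q)`-deformed `n`-bracket of the operators `L`:
for `n = 3` it is the 3-bracket, and for `n ≥ 4`,
`[L_{i_1},…,L_{i_n}] = Σ_{s=1}^n (−1)^{s+1} (pq)^{x·i_s + y·(i_1+⋯+î_s+⋯+i_n)}
L_{i_s} ∘ [L_{i_1},…,L̂_{i_s},…,L_{i_n}]` (hats denoting omission); the degenerate
cases `n ≤ 2` are set to `0`. -/
noncomputable def nBracket {K : Type*} [Field K] (p q : K)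
    (L : ℤ → ((ℤ →₀ K) →ₗ[K] (ℤ →₀ K))) :
    (n : ℕ) → (Fin n → ℤ) → ((ℤ →₀ K) →ₗ[K] (ℤ →₀ K))
  | 0, _ => 0
  | 1, _ => 0
  | 2, _ => 0
  | 3, i => threeBracket p q L (i 0) (i 1) (i 2)
  | (m + 4), i =>
      ∑ s : Fin (m + 4),
        ((-1 : K) ^ (s : ℕ) *
          (p * q) ^ (xPar (m + 4) * i s +
            yPar (m + 4) * ∑ j : Fin (m + 3), i (s.succAbove j))) •
          (L (i s) ∘ₗ nBracket p q L (m + 3) (fun j => i (s.succAbove j)))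

/-- Vandermonde determinant with exponents given by rows. -/
noncomputable def vdm {K : Type*} [Field K] {n : ℕ} (X : Fin n → K) : K :=
  Matrix.det (Matrix.of fun r j : Fin n => X j ^ (r : ℕ))

lemma vwC_eq {K : Type*} [Field K] (p q : K) (hp : p ≠ 0) (hq : q ≠ 0) (n : ℕ) (i : Fin n → ℤ) :
    vwC p q n i = (p * q) ^ (-(((n - 1) / 2 : ℕ) : ℤ) * ∑ j, i j) *
      vdm (fun j => (p * q) ^ (i j)) := by
  unfold vwC vdm
  generalize (((n - 1) / 2 : ℕ) : ℤ) = a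
  have h : (Matrix.of fun r j : Fin n => p ^ (((r : ℤ) - 2 * a) * i j) * q ^ ((r : ℤ) * i j)) =
      Matrix.of fun r j : Fin n => (p ^ (-2 * a * i j)) *
        (Matrix.of (fun r j : Fin n => ((p * q) ^ (i j)) ^ (r : ℕ)) r j) := by
    ext r j
    simp only [Matrix.of_apply]
    rw [← zpow_natCast, ← zpow_mul, mul_zpow, ← mul_assoc, ← zpow_add₀ hp]
    congr 2 <;> ring
  rw [h, Matrix.det_mul_row, ← mul_assoc]
  congr 1
  have h2 : ∏ j, p ^ (-2 * a * i j) = p ^ (-2 * a * ∑ j, i j) := by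
    rw [Finset.mul_sum]
    generalize (Finset.univ : Finset (Fin n)) = s
    induction s using Finset.cons_induction with
    | empty => simp
    | cons x s hx ih => rw [Finset.prod_cons, Finset.sum_cons, ih, zpow_add₀ hp]
  rw [h2, mul_zpow, mul_zpow, inv_zpow', mul_right_comm, ← zpow_add₀ hp]
  congr 2 <;> ring

lemma lap {K : Type*} [Field K] {n : ℕ} (X : Fin (n + 1) → K) (e : ℕ) :
    ∑ s : Fin (n + 1), (-1 : K) ^ (s : ℕ) * (X s ^ e * vdm (fun j => X (s.succAbove j))) =
      (-1) ^ n * Matrix.det (Matrix.of fun r j : Fin (n + 1) =>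
        X j ^ (if r = Fin.last n then e else (r : ℕ))) := by
  rw [Matrix.det_succ_row _ (Fin.last n), Finset.mul_sum]
  refine Finset.sum_congr rfl fun s _ => ?_
  have h : (Matrix.of fun r j : Fin (n + 1) =>
        X j ^ (if r = Fin.last n then e else (r : ℕ))).submatrix (Fin.last n).succAbove s.succAbove
      = Matrix.of fun r j : Fin n => X (s.succAbove j) ^ (r : ℕ) := by
    ext r j
    simp [Fin.succAbove_last, Fin.castSucc_ne_last]
  rw [h]
  simp only [Matrix.of_apply, if_true, vdm, Fin.val_last, pow_add]
  have : ((-1 : K) ^ n) * (-1) ^ n = 1 := by rw [← mul_pow]; simp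
  linear_combination (-(-1 : K) ^ (s : ℕ) * (X s ^ e * (Matrix.of fun r j : Fin n => X (s.succAbove j) ^ (r : ℕ)).det)) * this

lemma lap_top {K : Type*} [Field K] {n : ℕ} (X : Fin (n + 1) → K) :
    ∑ s : Fin (n + 1), (-1 : K) ^ (s : ℕ) * (X s ^ n * vdm (fun j => X (s.succAbove j))) =
      (-1) ^ n * vdm X := by
  rw [lap, vdm]
  congr 2
  ext r j
  simp only [Matrix.of_apply]
  split_ifs with h
  · simp [h]
  · rfl

lemma lap_zero {K : Type*} [Field K] {n : ℕ} (X : Fin (n + 2) → K) :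
    ∑ s : Fin (n + 2), (-1 : K) ^ (s : ℕ) * (X s ^ n * vdm (fun j => X (s.succAbove j))) = 0 := by
  rw [lap]
  rw [Matrix.det_zero_of_row_eq (i := Fin.last (n + 1)) (j := (Fin.last n).castSucc)]
  · simp
  · exact (Fin.castSucc_ne_last _).symm
  · ext j
    simp [Fin.castSucc_ne_last]

lemma vwL_apply {K : Type*} [Field K] (p q : K) (hp : p ≠ 0) (hq : q ≠ 0)
    (L : ℤ → ((ℤ →₀ K) →ₗ[K] (ℤ →₀ K)))
    (hL : ∀ m k : ℤ, L m (Finsupp.single k 1) =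
      (-(p ^ (m + k) * ((q ^ k - p ^ (-k)) / (q - p⁻¹)))) • Finsupp.single (m + k) (1 : K))
    (m k : ℤ) : L m (Finsupp.single k 1) =
      (-(p ^ m * (((p * q) ^ k - 1) * (q - p⁻¹)⁻¹))) • Finsupp.single (m + k) (1 : K) := by
  rw [hL, zpow_add₀ hp, mul_zpow, zpow_neg]
  congr 2
  have := zpow_ne_zero k hp
  rw [div_eq_mul_inv]
  generalize (q - p⁻¹)⁻¹ = d
  field_simp

lemma end_ext {K : Type*} [Field K] (A B : (ℤ →₀ K) →ₗ[K] (ℤ →₀ K))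
    (h : ∀ k, A (Finsupp.single k 1) = B (Finsupp.single k 1)) : A = B := by
  ext1 k
  ext1
  simpa using h k

lemma base_case {K : Type*} [Field K] (p q : K) (hp : p ≠ 0) (hq : q ≠ 0)
    (hpq : q - p⁻¹ ≠ 0)
    (L : ℤ → ((ℤ →₀ K) →ₗ[K] (ℤ →₀ K)))
    (hL : ∀ m k : ℤ, L m (Finsupp.single k 1) =
      (-(p ^ (m + k) * ((q ^ k - p ^ (-k)) / (q - p⁻¹)))) • Finsupp.single (m + k) (1 : K))
    (i : Fin 3 → ℤ) :
      nBracket p q L 3 i =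
        (-1 * (q - p⁻¹) ^ (1 - ((3 : ℕ) : ℤ)) * vwC p q 3 i) • L (∑ j, i j) := by
  have hL' := vwL_apply p q hp hq L hL
  rw [vwC_eq p q hp hq]
  apply end_ext
  intro l
  simp only [nBracket, threeBracket, defComm, vdm, Matrix.det_fin_three, Fin.sum_univ_three,
    LinearMap.add_apply, LinearMap.sub_apply, LinearMap.smul_apply, LinearMap.comp_apply, hL',
    map_smul, map_sub, smul_smul, Matrix.of_apply]
  generalize i 0 = a
  generalize i 1 = b
  generalize i 2 = c
  rw [show b + (c + l) = b + c + l by ring, show c + (b + l) = b + c + l by ring,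
    show c + (a + l) = a + c + l by ring, show a + (c + l) = a + c + l by ring,
    show a + (b + l) = a + b + l by ring, show b + (a + l) = a + b + l by ring]
  simp only [hL', smul_smul, ← sub_smul, smul_sub]
  rw [show a + (b + c + l) = a + b + c + l by ring, show b + (a + c + l) = a + b + c + l by ring,
    show c + (a + b + l) = a + b + c + l by ring]
  simp only [← sub_smul, ← add_smul]
  congr 1
  have hd : (q - p⁻¹) ^ (1 - ((3 : ℕ) : ℤ)) = (q - p⁻¹)⁻¹ ^ 2 := by
    rw [show (1 - ((3 : ℕ) : ℤ)) = -((2 : ℕ) : ℤ) by norm_num, zpow_neg, zpow_natCast, inv_pow]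
  rw [hd]
  generalize (q - p⁻¹)⁻¹ = d
  simp only [show (-(((3 - 1) / 2 : ℕ) : ℤ) * (a + b + c)) = -(a + b + c) by norm_num,
    mul_zpow, zpow_sub₀ hq, zpow_neg, zpow_add₀ hp, zpow_add₀ hq]
  have h1 := zpow_ne_zero a hp
  have h2 := zpow_ne_zero b hp
  have h3 := zpow_ne_zero c hp
  have h4 := zpow_ne_zero a hq
  have h5 := zpow_ne_zero b hq
  have h6 := zpow_ne_zero c hq
  generalize p ^ a = A at *
  generalize p ^ b = B at *
  generalize p ^ c = C at *
  generalize q ^ a = A' at *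
  generalize q ^ b = B' at *
  generalize q ^ c = C' at *
  generalize p ^ l = E
  generalize q ^ l = E'
  simp
  field_simp
  ring

lemma step_case {K : Type*} [Field K] (p q : K) (hp : p ≠ 0) (hq : q ≠ 0)
    (hpq : q - p⁻¹ ≠ 0)
    (L : ℤ → ((ℤ →₀ K) →ₗ[K] (ℤ →₀ K)))
    (hL : ∀ m k : ℤ, L m (Finsupp.single k 1) =
      (-(p ^ (m + k) * ((q ^ k - p ^ (-k)) / (q - p⁻¹)))) • Finsupp.single (m + k) (1 : K))
    (m : ℕ) (ε : K)
    (ih : ∀ i : Fin (m + 3) → ℤ, nBracket p q L (m + 3) i =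
        (ε * (q - p⁻¹) ^ (1 - ((m + 3 : ℕ) : ℤ)) * vwC p q (m + 3) i) • L (∑ j, i j))
    (i : Fin (m + 4) → ℤ) :
      nBracket p q L (m + 4) i =
        (((-1) ^ (m + 3) * ε) * (q - p⁻¹) ^ (1 - ((m + 4 : ℕ) : ℤ)) * vwC p q (m + 4) i) •
          L (∑ j, i j) := by
  have hL' := vwL_apply p q hp hq L hL
  have ht : p * q ≠ 0 := mul_ne_zero hp hq
  rw [vwC_eq p q hp hq]
  apply end_ext
  intro l
  rw [nBracket]
  simp only [ih, vwC_eq p q hp hq, LinearMap.sum_apply, LinearMap.smul_apply,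
    LinearMap.comp_apply, hL', map_smul, smul_smul]
  have hS : ∀ s : Fin (m + 4), ∑ j, i (s.succAbove j) = (∑ j, i j) - i s := by
    intro s; rw [Fin.sum_univ_succAbove i s]; ring
  simp only [hS]
  generalize hSS : ∑ j, i j = S
  have hadd : ∀ s : Fin (m + 4), i s + (S - i s + l) = S + l := by intro s; ring
  simp only [hadd, ← Finset.sum_smul]
  congr 1
  have hd : (q - p⁻¹) ^ (1 - ((m + 4 : ℕ) : ℤ)) =
      (q - p⁻¹) ^ (1 - ((m + 3 : ℕ) : ℤ)) * (q - p⁻¹)⁻¹ := by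
    rw [← zpow_sub_one₀ hpq]; congr 1
  rw [hd]
  generalize (q - p⁻¹) ^ (1 - ((m + 3 : ℕ) : ℤ)) = D
  generalize (q - p⁻¹)⁻¹ = d
  have hx : ∀ s : Fin (m + 4), xPar (m + 4) * i s + yPar (m + 4) * (S - i s)
      + -(((m + 3 - 1) / 2 : ℕ) : ℤ) * (S - i s)
      = -(((m + 4 - 1) / 2 : ℕ) : ℤ) * S + i s * (m + 3 : ℕ) := by
    intro s
    have e1 : yPar (m + 4) - (((m + 3 - 1) / 2 : ℕ) : ℤ) = -(((m + 4 - 1) / 2 : ℕ) : ℤ) := by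
      unfold yPar; split_ifs <;> omega
    have e2 : xPar (m + 4) - (yPar (m + 4) - (((m + 3 - 1) / 2 : ℕ) : ℤ)) = (m + 3 : ℕ) := by
      unfold xPar yPar; split_ifs <;> omega
    linear_combination S * e1 + i s * e2
  set T := (p * q) ^ (-(((m + 4 - 1) / 2 : ℕ) : ℤ) * S) with hT
  set X : Fin (m + 4) → K := fun j => (p * q) ^ (i j) with hX
  have key : ∀ s : Fin (m + 4), (p * q) ^ (xPar (m + 4) * i s + yPar (m + 4) * (S - i s)) *
      (p * q) ^ (-(((m + 3 - 1) / 2 : ℕ) : ℤ) * (S - i s)) = T * X s ^ (m + 3) := by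
    intro s
    rw [← zpow_add₀ ht, hx, zpow_add₀ ht, zpow_mul _ (i s), zpow_natCast]
  have hXs : ∀ s, X s * (p * q) ^ (S - i s + l) = (p * q) ^ (S + l) := by
    intro s
    rw [hX, ← zpow_add₀ ht, hadd]
  have hps : ∀ s, p ^ (S - i s) * p ^ (i s) = p ^ S := by
    intro s
    rw [← zpow_add₀ hp]; congr 1; ring
  have l1 := lap_top X
  have l2 := lap_zero X
  have term : ∀ s : Fin (m + 4),
      (-1 : K) ^ (s : ℕ) * (p * q) ^ (xPar (m + 4) * i s + yPar (m + 4) * (S - i s)) *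
        (ε * D * ((p * q) ^ (-(((m + 3 - 1) / 2 : ℕ) : ℤ) * (S - i s)) *
            vdm fun j => (p * q) ^ i (s.succAbove j)) *
          -(p ^ (S - i s) * (((p * q) ^ l - 1) * d))) *
        -(p ^ i s * (((p * q) ^ (S - i s + l) - 1) * d)) =
      (ε * D * d * d * T * p ^ S * ((p * q) ^ l - 1)) *
        ((p * q) ^ (S + l) *
            ((-1 : K) ^ (s : ℕ) * (X s ^ (m + 2) * vdm (fun j => X (s.succAbove j)))) -
          ((-1 : K) ^ (s : ℕ) * (X s ^ (m + 3) * vdm (fun j => X (s.succAbove j))))) := by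
    intro s
    change _ * (ε * D * (_ * vdm fun j => X (s.succAbove j)) * _) * _ = _
    generalize (vdm fun j => X (s.succAbove j)) = W
    rw [← hXs s, ← hps s]
    linear_combination ((-1 : K) ^ (s : ℕ) * ε * D * W * p ^ (S - i s) * (((p * q) ^ l - 1) * d) *
      (p ^ i s * (((p * q) ^ (S - i s + l) - 1) * d))) * key s
  rw [Finset.sum_congr rfl fun s _ => ((mul_assoc _ _ _).symm.trans (term s)), ← Finset.mul_sum, Finset.sum_sub_distrib,
    ← Finset.mul_sum, l1, l2]
  ring

/-- **Lemma 4.** For every `n ≥ 3` there is a sign `ε_n ∈ {1, −1}`,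
depending only on `n`, such that for all integers `i₁,…,i_n`,
`[L_{i_1},…,L_{i_n}] = ε_n (q − p⁻¹)^{−(n−1)} c_n(i_1,…,i_n) · L_{i_1+⋯+i_n}`
as endomorphisms of `V = ℤ →₀ K`. -/
theorem pq_n_bracket_closed_form
    {K : Type*} [Field K] (p q : K) (hp : p ≠ 0) (hq : q ≠ 0)
    (hpq : q - p⁻¹ ≠ 0)
    (L : ℤ → ((ℤ →₀ K) →ₗ[K] (ℤ →₀ K)))
    (hL : ∀ m k : ℤ, L m (Finsupp.single k 1) =
      (-(p ^ (m + k) * ((q ^ k - p ^ (-k)) / (q - p⁻¹)))) • Finsupp.single (m + k) (1 : K))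
    (n : ℕ) (hn : 3 ≤ n) :
    ∃ ε : K, (ε = 1 ∨ ε = -1) ∧ ∀ i : Fin n → ℤ,
      nBracket p q L n i =
        (ε * (q - p⁻¹) ^ (1 - (n : ℤ)) * vwC p q n i) • L (∑ j, i j) := by
  obtain ⟨m, rfl⟩ : ∃ m, n = m + 3 := ⟨n - 3, by omega⟩
  clear hn
  induction m with
  | zero => exact ⟨-1, Or.inr rfl, base_case p q hp hq hpq L hL⟩
  | succ m ih =>
    obtain ⟨ε, hε, h⟩ := ih
    refine ⟨(-1) ^ (m + 3) * ε, ?_, step_case p q hp hq hpq L hL m ε h⟩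
    rcases neg_one_pow_eq_or K (m + 3) with h1 | h1 <;> rcases hε with h2 | h2 <;> simp [h1, h2]
end

section
/- Let n = 2k be even with k ≥ 2 and let S = {−k+1, −k+2, …, k}. Then the K-linear span A of {e_i : i ∈ S} is closed under the (p,q)-deformed Virasoro–Witt n-bracket; in particular [e_{−k+1}, e_{−k+2}, …, e_k] = c_n(−k+1, …, k)·e_k since (−k+1) + (−k+2) + ⋯ + k = k ∈ S. Moreover, the restricted bracket on A satisfies the Filippov fundamental identity, so A is an n-Lie subalgebra. -/
/-- The `(p,q)`-deformed Virasoro–Witt `n`-bracket: the (alternating) `n`-multilinear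
map on the free module `ℤ →₀ K` determined on basis vectors by
`[e_{i_1},…,e_{i_n}] = c_n(i_1,…,i_n) • e_{i_1+⋯+i_n}`. -/
noncomputable def vwBr {K : Type*} [Field K] (p q : K) (n : ℕ)
    (v : Fin n → (ℤ →₀ K)) : ℤ →₀ K :=
  ∑ f ∈ Fintype.piFinset (fun j => (v j).support),
    ((∏ j, v j (f j)) * vwC p q n f) • Finsupp.single (∑ j, f j) (1 : K)

/-- The Filippov fundamental identity for the tuples `(Y₁,…,Y_{n−1})` (the first `n−1`
components of `Y`) and `(X₁,…,X_n)`: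
`[Y_1,…,Y_{n−1},[X_1,…,X_n]] = Σ_{k=1}^n [X_1,…,[Y_1,…,Y_{n−1},X_k],…,X_n]`. -/
noncomputable def holdsFI {K : Type*} [Field K] (p q : K) (n : ℕ) (hn : 0 < n)
    (Y X : Fin n → (ℤ →₀ K)) : Prop :=
  vwBr p q n (Function.update Y ⟨n - 1, Nat.sub_lt hn Nat.one_pos⟩ (vwBr p q n X)) =
    ∑ k : Fin n, vwBr p q n (Function.update X k
      (vwBr p q n (Function.update Y ⟨n - 1, Nat.sub_lt hn Nat.one_pos⟩ (X k))))

/-- The increasing enumeration of `{-k+1,…,k}`. -/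
def gg (k : ℕ) (j : Fin (2 * k)) : ℤ := -(k : ℤ) + 1 + ((j : ℕ) : ℤ)

lemma gg_injective (k : ℕ) : Function.Injective (gg k) := by
  intro a b h
  simp only [gg] at h
  ext
  omega

lemma gg_image (k : ℕ) : (Finset.univ.image (gg k)) = Finset.Icc (-(k : ℤ) + 1) (k : ℤ) := by
  ext x
  simp only [Finset.mem_image, Finset.mem_univ, true_and, Finset.mem_Icc, gg]
  constructor
  · rintro ⟨j, rfl⟩
    have := j.2
    omega
  · rintro ⟨h1, h2⟩
    exact ⟨⟨(x + k - 1).toNat, by omega⟩, by simp only; omega⟩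

lemma gg_sum (k : ℕ) : ∑ j, gg k j = (k : ℤ) := by
  have h : ∀ m : ℕ, (∑ j ∈ Finset.range m, (j : ℤ)) * 2 = m * (m - 1) := by
    intro m
    induction m with
    | zero => simp
    | succ m ih => rw [Finset.sum_range_succ, add_mul, ih]; push_cast; ring
  have h2 := h (2 * k)
  simp only [gg, Finset.sum_add_distrib, Finset.sum_const, Finset.card_univ, Fintype.card_fin]
  rw [Fin.sum_univ_eq_sum_range (fun j => (j : ℤ)) (2 * k)]
  simp only [nsmul_eq_mul]
  push_cast at h2 ⊢
  linarith

lemma vwC_not_inj {K : Type*} [Field K] (p q : K) (n : ℕ) (i : Fin n → ℤ)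
    (h : ¬ Function.Injective i) : vwC p q n i = 0 := by
  rw [Function.not_injective_iff] at h
  obtain ⟨a, b, hab, hne⟩ := h
  unfold vwC
  rw [Matrix.det_zero_of_column_eq hne, mul_zero]
  intro r
  simp [hab]

lemma vwC_perm {K : Type*} [Field K] (p q : K) (n : ℕ) (i : Fin n → ℤ)
    (σ : Equiv.Perm (Fin n)) :
    vwC p q n (fun j => i (σ j)) = ((Equiv.Perm.sign σ : ℤ) : K) * vwC p q n i := by
  unfold vwC
  rw [Equiv.sum_comp σ i]
  have := Matrix.det_permute' σ (Matrix.of fun r j : Fin n =>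
      p ^ (((r : ℤ) - 2 * (((n - 1) / 2 : ℕ) : ℤ)) * i j) * q ^ ((r : ℤ) * i j))
  rw [mul_left_comm, ← this]
  rfl

/-- Coordinate matrix. -/
def coordM {K : Type*} [Field K] (k : ℕ) (v : Fin (2 * k) → (ℤ →₀ K)) :
    Matrix (Fin (2 * k)) (Fin (2 * k)) K :=
  Matrix.of fun i j => v j (gg k i)

lemma vwBr_eq {K : Type*} [Field K] (p q : K) (k : ℕ) (v : Fin (2 * k) → (ℤ →₀ K))
    (hv : ∀ j, (v j).support ⊆ Finset.Icc (-(k : ℤ) + 1) (k : ℤ)) :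
    vwBr p q (2 * k) v =
      (coordM k v).det • (vwC p q (2 * k) (gg k) • Finsupp.single (k : ℤ) (1 : K)) := by
  have h1 : vwBr p q (2 * k) v = ∑ f ∈ Fintype.piFinset
      (fun _ : Fin (2 * k) => Finset.Icc (-(k : ℤ) + 1) (k : ℤ)),
      ((∏ j, v j (f j)) * vwC p q (2 * k) f) • Finsupp.single (∑ j, f j) (1 : K) := by
    unfold vwBr
    apply Finset.sum_subset (Fintype.piFinset_subset _ _ hv)
    intro f _ hf
    rw [Fintype.mem_piFinset] at hf
    push Not at hf
    obtain ⟨a, ha⟩ := hf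
    have h0 : v a (f a) = 0 := Finsupp.notMem_support_iff.mp ha
    have hp0 : ∏ j, v j (f j) = 0 := Finset.prod_eq_zero (Finset.mem_univ a) h0
    rw [hp0, zero_mul, zero_smul]
  rw [h1, Matrix.det_apply', Finset.sum_smul]
  symm
  refine Finset.sum_of_injOn (fun σ : Equiv.Perm (Fin (2 * k)) => fun j => gg k (σ j)) ?_ ?_ ?_ ?_
  · intro σ _ τ _ h
    ext j
    exact congrArg Fin.val (gg_injective k (congrFun h j))
  · intro σ _
    simp only [Finset.mem_coe, Fintype.mem_piFinset, ← gg_image]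
    intro a
    exact Finset.mem_image_of_mem _ (Finset.mem_univ _)
  · intro f hf hn
    rw [vwC_not_inj, mul_zero, zero_smul]
    intro hinj
    apply hn
    simp only [Fintype.mem_piFinset, ← gg_image, Finset.mem_image, Finset.mem_univ,
      true_and] at hf
    choose h hh using hf
    have hi : Function.Injective h := by
      intro a b hab
      apply hinj
      rw [← hh a, ← hh b, hab]
    refine ⟨Equiv.ofBijective h (Finite.injective_iff_bijective.mp hi), by simp, ?_⟩
    funext j
    exact hh j
  · intro σ _
    rw [vwC_perm, Equiv.sum_comp σ (gg k), gg_sum, smul_smul]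
    congr 1
    simp only [coordM, Matrix.of_apply]
    ring

lemma coordM_update {K : Type*} [Field K] (k : ℕ) (v : Fin (2 * k) → (ℤ →₀ K))
    (l : Fin (2 * k)) (x : ℤ →₀ K) :
    (coordM k (Function.update v l x)).det = (coordM k v).cramer (fun i => x (gg k i)) l := by
  rw [Matrix.cramer_apply]
  congr 1
  ext i j
  by_cases h : j = l
  · subst h; simp [coordM]
  · simp [coordM, h]

/-- Let `n = 2k` be even with `k ≥ 2` and `S = {−k+1,…,k}`. The span
`A` of `{e_i : i ∈ S}` is closed under the `(p,q)`-deformed Virasoro–Witt `n`-bracket;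
in particular `[e_{−k+1},…,e_k] = c_n(−k+1,…,k) • e_k` (since `(−k+1)+⋯+k = k ∈ S`),
and the restricted bracket satisfies the Filippov fundamental identity, so `A` is an
`n`-Lie subalgebra. -/
theorem even_n_Lie_subalgebra
    {K : Type*} [Field K] (p q : K) (hp : p ≠ 0) (hq : q ≠ 0)
    (k : ℕ) (hk : 2 ≤ k)
    (A : Submodule K (ℤ →₀ K))
    (hA : A = Submodule.span K
      ((fun i : ℤ => Finsupp.single i (1 : K)) '' ↑(Finset.Icc (-(k : ℤ) + 1) (k : ℤ)))) :
    (∀ v : Fin (2 * k) → (ℤ →₀ K), (∀ j, v j ∈ A) → vwBr p q (2 * k) v ∈ A) ∧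
    vwBr p q (2 * k) (fun j : Fin (2 * k) => Finsupp.single (-(k : ℤ) + 1 + ((j : ℕ) : ℤ)) 1) =
      vwC p q (2 * k) (fun j : Fin (2 * k) => -(k : ℤ) + 1 + ((j : ℕ) : ℤ)) •
        Finsupp.single ((k : ℤ)) (1 : K) ∧
    (∀ Y X : Fin (2 * k) → (ℤ →₀ K), (∀ j, Y j ∈ A) → (∀ j, X j ∈ A) →
      holdsFI p q (2 * k) (by omega) Y X) := by
  have hmem : ∀ x : ℤ →₀ K, x ∈ A ↔ x.support ⊆ Finset.Icc (-(k : ℤ) + 1) (k : ℤ) := by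
    intro x
    rw [hA, ← Finsupp.supported_eq_span_single, Finsupp.mem_supported, Finset.coe_subset]
  have hw : ∀ c : K, c • (vwC p q (2 * k) (gg k) • Finsupp.single (k : ℤ) (1 : K)) ∈ A := by
    intro c
    refine A.smul_mem _ (A.smul_mem _ ?_)
    rw [hA]
    refine Submodule.subset_span ⟨k, ?_, rfl⟩
    simp only [Finset.coe_Icc, Set.mem_Icc]
    omega
  have hbr : ∀ v : Fin (2 * k) → (ℤ →₀ K), (∀ j, v j ∈ A) → vwBr p q (2 * k) v =
      (coordM k v).det • (vwC p q (2 * k) (gg k) • Finsupp.single (k : ℤ) (1 : K)) :=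
    fun v hv => vwBr_eq p q k v fun j => (hmem _).mp (hv j)
  have hcl : ∀ v : Fin (2 * k) → (ℤ →₀ K), (∀ j, v j ∈ A) → vwBr p q (2 * k) v ∈ A := by
    intro v hv
    rw [hbr v hv]
    exact hw _
  refine ⟨hcl, ?_, ?_⟩
  · rw [hbr]
    · have h1 : coordM k (fun j : Fin (2 * k) =>
          (Finsupp.single (-(k : ℤ) + 1 + ((j : ℕ) : ℤ)) 1 : ℤ →₀ K)) = 1 := by
        ext i j
        simp only [coordM, Matrix.of_apply, Matrix.one_apply]
        change (Finsupp.single (gg k j) (1 : K)) (gg k i) = _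
        rw [Finsupp.single_apply]
        simp only [(gg_injective k).eq_iff, eq_comm]
      rw [h1, Matrix.det_one, one_smul]
      rfl
    · intro j
      rw [hA]
      refine Submodule.subset_span ⟨_, ?_, rfl⟩
      have := j.2
      simp only [Finset.coe_Icc, Set.mem_Icc]
      omega
  · intro Y X hY hX
    have hup : ∀ (v : Fin (2 * k) → (ℤ →₀ K)) (l : Fin (2 * k)) (x : ℤ →₀ K),
        (∀ j, v j ∈ A) → x ∈ A → ∀ j, Function.update v l x j ∈ A := by
      intro v l x hv hx j
      by_cases h : j = l
      · subst h; simpa using hx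
      · simpa [h] using hv j
    unfold holdsFI
    generalize (⟨2 * k - 1, _⟩ : Fin (2 * k)) = l
    have hin : ∀ m, vwBr p q (2 * k) (Function.update Y l (X m)) ∈ A :=
      fun m => hcl _ (hup _ _ _ hY (hX m))
    rw [hbr _ (hup _ _ _ hY (hcl X hX)), hbr X hX]
    rw [Finset.sum_congr rfl fun m _ => hbr _ (hup X m _ hX (hin m))]
    rw [Finset.sum_congr rfl fun m _ => by rw [hbr _ (hup _ _ _ hY (hX m))]]
    generalize vwC p q (2 * k) (gg k) • Finsupp.single (k : ℤ) (1 : K) = w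
    rw [← Finset.sum_smul]
    congr 1
    simp only [coordM_update]
    have key : ∀ (M : Matrix (Fin (2 * k)) (Fin (2 * k)) K) (c : K) (m : Fin (2 * k)),
        M.cramer (fun i => (c • w) (gg k i)) m = c * M.cramer (fun i => w (gg k i)) m := by
      intro M c m
      have : (fun i => (c • w) (gg k i)) = c • (fun i => w (gg k i)) := by
        ext i; simp
      rw [this, map_smul]
      simp
    simp only [key]
    have h := congrArg (fun u => (coordM k Y).cramer u l)
      (Matrix.mulVec_cramer (coordM k X) (fun i => w (gg k i)))
    simp only [Matrix.mulVec_eq_sum, map_sum, map_smul, Finset.sum_apply, Pi.smul_apply,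
      smul_eq_mul, op_smul_eq_smul] at h
    rw [← h]
    refine Finset.sum_congr rfl fun m _ => ?_
    rw [mul_comm]
    rfl
end

section
/- (Corollary 8.) Let n ≥ 3, K = ℚ(p,q), and let S ⊆ ℤ be a finite set of integers such that the span A of {e_i : i ∈ S} is closed under the (p,q)-deformed Virasoro–Witt n-bracket, satisfies the Filippov fundamental identity on A, and the bracket does not vanish identically on A. Then A is not a simple n-Lie algebra: the one-dimensional subspace I = K·e_σ, where σ = Σ_{i ∈ S} i, is a nonzero proper ideal of A, i.e. [a₁, …, a_{n−1}, x] ∈ I for all a₁, …, a_{n−1} ∈ A and x ∈ I. -/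
/-- The field `K = ℚ(p,q)` of rational functions in two variables over `ℚ`. -/
abbrev Kpq : Type := FractionRing (MvPolynomial (Fin 2) ℚ)

/-- The image of the first variable `p` in `ℚ(p,q)`. -/
noncomputable def pVar : Kpq :=
  algebraMap (MvPolynomial (Fin 2) ℚ) Kpq (MvPolynomial.X 0)

/-- The image of the second variable `q` in `ℚ(p,q)`. -/
noncomputable def qVar : Kpq :=
  algebraMap (MvPolynomial (Fin 2) ℚ) Kpq (MvPolynomial.X 1)

theorem vwC_formula {K : Type*} [Field K] (p q : K) (hp : p ≠ 0) (hq : q ≠ 0) (n : ℕ)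
    (f : Fin n → ℤ) :
    vwC p q n f = (p * q) ^ (-(((n - 1) / 2 : ℕ) : ℤ) * ∑ j, f j) *
      (Matrix.vandermonde (fun j => (p * q) ^ f j)).det := by
  unfold vwC
  set m : ℤ := (((n - 1) / 2 : ℕ) : ℤ)
  have h1 : (Matrix.of fun r j : Fin n =>
      p ^ (((r : ℤ) - 2 * m) * f j) * q ^ ((r : ℤ) * f j)) =
      Matrix.of fun r j : Fin n => p ^ (-2 * m * f j) *
        (Matrix.vandermonde (fun j => (p * q) ^ f j)).transpose r j := by
    ext r j
    simp only [Matrix.of_apply, Matrix.transpose_apply, Matrix.vandermonde_apply]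
    rw [← zpow_natCast, ← zpow_mul, mul_zpow, ← mul_assoc, ← zpow_add₀ hp]
    congr 2 <;> ring
  rw [h1, Matrix.det_mul_row, Matrix.det_transpose, ← mul_assoc]
  congr 1
  have h2 : ∏ j, p ^ (-2 * m * f j) = p ^ (-2 * m * ∑ j, f j) := by
    rw [Finset.mul_sum]
    induction (Finset.univ : Finset (Fin n)) using Finset.induction_on with
    | empty => simp
    | insert a s ha ih => rw [Finset.prod_insert ha, Finset.sum_insert ha, zpow_add₀ hp, ih]
  rw [h2, mul_zpow, mul_zpow, inv_zpow', mul_right_comm, ← zpow_add₀ hp]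
  congr 2 <;> ring

theorem vwC_ne_zero_iff {K : Type*} [Field K] (p q : K) (hp : p ≠ 0) (hq : q ≠ 0)
    (ht : Function.Injective fun k : ℤ => (p * q) ^ k) (n : ℕ) (f : Fin n → ℤ) :
    vwC p q n f ≠ 0 ↔ Function.Injective f := by
  rw [vwC_formula p q hp hq, mul_ne_zero_iff, Matrix.det_vandermonde_ne_zero_iff]
  constructor
  · rintro ⟨-, h⟩ a b hab
    exact h (by simp [hab])
  · intro h
    exact ⟨zpow_ne_zero _ (mul_ne_zero hp hq), ht.comp h⟩

theorem vwBr_single {K : Type*} [Field K] (p q : K) (n : ℕ) (f : Fin n → ℤ) (b : Fin n → K) :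
    vwBr p q n (fun j => Finsupp.single (f j) (b j)) =
      Finsupp.single (∑ j, f j) ((∏ j, b j) * vwC p q n f) := by
  unfold vwBr
  by_cases hb : ∀ j, b j ≠ 0
  · have : Fintype.piFinset (fun j => (Finsupp.single (f j) (b j)).support) = {f} := by
      rw [← Fintype.piFinset_singleton]
      congr 1
      ext1 j
      exact Finsupp.support_single _ (hb j)
    rw [this]
    simp
  · push Not at hb
    obtain ⟨j, hj⟩ := hb
    rw [Finset.prod_eq_zero (Finset.mem_univ j) hj]
    simp only [zero_mul, Finsupp.single_zero]
    apply Finset.sum_eq_zero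
    intro g _
    rw [Finset.prod_eq_zero (Finset.mem_univ j) (by simp [hj])]
    simp

theorem det_vandermonde_snoc {K : Type*} [Field K] (k : ℕ) (y : Fin k → K) (x : K) :
    (Matrix.vandermonde (Fin.snoc (α := fun _ => K) y x : Fin (k + 1) → K)).det =
      (Matrix.vandermonde y).det * ∏ i, (x - y i) := by
  have key : ∀ (l : ℕ) (v : Fin l → K), (Matrix.vandermonde v).det =
      ∏ i, ∏ j, if i < j then v j - v i else 1 := by
    intro l v
    rw [Matrix.det_vandermonde]
    refine Finset.prod_congr rfl fun i _ => ?_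
    rw [← Finset.prod_filter]
    refine Finset.prod_congr ?_ fun _ _ => rfl
    ext j; simp
  rw [key, key]
  simp only [Fin.prod_univ_castSucc, Fin.snoc_castSucc, Fin.snoc_last, Fin.castSucc_lt_castSucc_iff,
    Fin.castSucc_lt_last, if_true, lt_irrefl, if_false, mul_one]
  rw [Finset.prod_mul_distrib]
  have : ∀ i : Fin k, ¬ (Fin.last k < i.castSucc) := fun i => by
    simpa using (Fin.castSucc_lt_last i).le
  simp [this]

/-- The trace of the diagonal derivation does not vanish. -/
theorem vwC_add_ne_zero {K : Type*} [Field K] [CharZero K] (p q : K) (hp : p ≠ 0) (hq : q ≠ 0)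
    (ht : Function.Injective fun k : ℤ => (p * q) ^ k) (k : ℕ) (T : Finset ℤ)
    (hT : T.card = k) (hneg : ∀ x ∈ T, -x ∈ T) (y : Fin k → ℤ) (hy : Function.Injective y)
    (hyT : Finset.univ.image y = T) (a : ℤ) (ha0 : a ≠ 0) (ha : a ∉ T) :
    vwC p q (k + 1) (Fin.snoc (α := fun _ => ℤ) y a) +
      vwC p q (k + 1) (Fin.snoc (α := fun _ => ℤ) y (-a)) ≠ 0 := by
  have htne : p * q ≠ 0 := mul_ne_zero hp hq
  rw [vwC_formula p q hp hq, vwC_formula p q hp hq]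
  set t := p * q
  have hsn : ∀ x : ℤ, (fun j => t ^ ((Fin.snoc (α := fun _ => ℤ) y x : Fin (k+1) → ℤ) j)) =
      (Fin.snoc (α := fun _ => K) (fun j => t ^ y j) (t ^ x) : Fin (k + 1) → K) := by
    intro x
    ext j
    refine Fin.lastCases ?_ (fun i => ?_) j <;> simp
  rw [hsn, hsn, det_vandermonde_snoc, det_vandermonde_snoc]
  have hsum0 : ∑ x ∈ T, x = 0 := by
    have h : ∑ x ∈ T, x = ∑ x ∈ T, -x :=
      Finset.sum_nbij' (fun x => -x) (fun x => -x) hneg hneg (by simp) (by simp) (by simp)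
    rw [Finset.sum_neg_distrib] at h
    omega
  have hysum : ∑ i, y i = 0 := by
    rw [← hsum0, ← hyT, Finset.sum_image (fun _ _ _ _ h => hy h)]
  have hprodT : ∀ x : ℤ, ∏ i, (t ^ x - t ^ y i) = ∏ z ∈ T, (t ^ x - t ^ z) := by
    intro x
    rw [← hyT, Finset.prod_image (fun _ _ _ _ h => hy h)]
  have hP : ∏ z ∈ T, (t ^ (-a) - t ^ z) =
      (-1) ^ k * t ^ (-(k : ℤ) * a) * ∏ z ∈ T, (t ^ a - t ^ z) := by
    have e1 : ∏ z ∈ T, (t ^ (-a) - t ^ z) = ∏ z ∈ T, (t ^ (-a) - t ^ (-z)) :=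
      Finset.prod_nbij' (fun x => -x) (fun x => -x) hneg hneg (by simp) (by simp) (by simp)
    have e2 : ∀ z : ℤ, t ^ (-a) - t ^ (-z) = (-1) * t ^ (-a) * t ^ (-z) * (t ^ a - t ^ z) := by
      intro z
      have h1 : t ^ a ≠ 0 := zpow_ne_zero _ htne
      have h2 : t ^ z ≠ 0 := zpow_ne_zero _ htne
      rw [zpow_neg, zpow_neg]
      field_simp
      ring
    have e3 : ∀ U : Finset ℤ, ∏ z ∈ U, t ^ (-z) = t ^ (-∑ z ∈ U, z) := by
      intro U
      induction U using Finset.induction_on with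
      | empty => simp
      | insert b s hb ih =>
        rw [Finset.prod_insert hb, Finset.sum_insert hb, neg_add, zpow_add₀ htne, ih]
    rw [e1, Finset.prod_congr rfl fun z _ => e2 z]
    rw [Finset.prod_mul_distrib, Finset.prod_mul_distrib, e3, hsum0, Finset.prod_const, hT,
      mul_pow, ← zpow_natCast (t ^ (-a)), ← zpow_mul]
    simp only [neg_zero, zpow_zero, mul_one]
    congr 3; ring
  rw [hprodT, hprodT, hP]
  have hV : (Matrix.vandermonde (fun j => t ^ y j)).det ≠ 0 :=
    Matrix.det_vandermonde_ne_zero_iff.2 (ht.comp hy)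
  have hQ : ∏ z ∈ T, (t ^ a - t ^ z) ≠ 0 := by
    rw [Finset.prod_ne_zero_iff]
    intro z hz h
    have : a = z := ht (sub_eq_zero.1 h)
    exact ha (this ▸ hz)
  simp only [Fin.sum_univ_castSucc, Fin.snoc_castSucc, Fin.snoc_last, hysum, zero_add,
    Nat.add_sub_cancel]
  set V := (Matrix.vandermonde (fun j => t ^ y j)).det
  set Q := ∏ z ∈ T, (t ^ a - t ^ z)
  set m : ℤ := ((k / 2 : ℕ) : ℤ) with hm
  have hfac : t ^ (-m * a) * (V * Q) + t ^ (-m * -a) * (V * ((-1) ^ k * t ^ (-(k : ℤ) * a) * Q)) =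
      t ^ (-m * a) * V * Q * (1 + (-1) ^ k * t ^ ((2 * m - k) * a)) := by
    have : t ^ (-m * -a) * t ^ (-(k : ℤ) * a) = t ^ (-m * a) * t ^ ((2 * m - k) * a) := by
      rw [← zpow_add₀ htne, ← zpow_add₀ htne]; congr 1; ring
    linear_combination V * Q * (-1) ^ k * this
  rw [hfac]
  refine mul_ne_zero (mul_ne_zero (mul_ne_zero (zpow_ne_zero _ htne) hV) hQ) ?_
  rcases Nat.even_or_odd' k with ⟨c, hc | hc⟩
  · have h0 : 2 * m - (k : ℤ) = 0 := by omega
    rw [h0, hc]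
    simp only [zero_mul, zpow_zero, pow_mul]
    norm_num
  · have h0 : 2 * m - (k : ℤ) = -1 := by omega
    rw [h0, hc, pow_succ, pow_mul]
    intro h
    have h' : t ^ (-1 * a) = t ^ (0 : ℤ) := by
      rw [zpow_zero]
      have h1 : ((-1 : K) ^ 2) ^ c * -1 = -1 := by norm_num
      rw [h1] at h
      linear_combination -h
    have := ht h'
    omega

theorem pVar_ne : pVar ≠ 0 := by
  unfold pVar
  rw [Ne, FaithfulSMul.algebraMap_eq_zero_iff]
  exact MvPolynomial.X_ne_zero _

theorem qVar_ne : qVar ≠ 0 := by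
  unfold qVar
  rw [Ne, FaithfulSMul.algebraMap_eq_zero_iff]
  exact MvPolynomial.X_ne_zero _

theorem pq_pow_ne (k : ℕ) (h : (pVar * qVar) ^ k = 1) : k = 0 := by
  unfold pVar qVar at h
  rw [← map_mul, ← map_pow, ← map_one (algebraMap (MvPolynomial (Fin 2) ℚ) Kpq)] at h
  have h2 := FaithfulSMul.algebraMap_injective _ _ h
  have h3 := congrArg (MvPolynomial.eval (fun _ => (0 : ℚ))) h2
  by_contra hk
  simp [hk] at h3

theorem pq_inj : Function.Injective fun k : ℤ => (pVar * qVar) ^ k := by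
  have hne : pVar * qVar ≠ 0 := mul_ne_zero pVar_ne qVar_ne
  have key : ∀ k : ℤ, (pVar * qVar) ^ k = 1 → k = 0 := by
    intro k hk
    obtain ⟨l, rfl | rfl⟩ := k.eq_nat_or_neg
    · have := pq_pow_ne l (by simpa using hk)
      simp [this]
    · have := pq_pow_ne l (by simpa using hk)
      simp [this]
  intro a b hab
  have := key (a - b) (by rw [zpow_sub₀ hne]; simp only at hab; rw [hab]; exact div_self (zpow_ne_zero _ hne))
  omega

/-- A finite set of integers of more than `n` elements, closed under sums of `n` distinct elements,
has exactly `n + 1` elements. -/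
theorem card_le_of_sums (n : ℕ) (hn : 3 ≤ n) (S : Finset ℤ)
    (hS : ∀ T ⊆ S, T.card = n → ∑ x ∈ T, x ∈ S) : S.card ≤ n + 1 := by
  by_contra hcon
  push Not at hcon
  obtain ⟨k, rfl⟩ : ∃ k, n = k + 1 := ⟨n - 1, by omega⟩
  obtain ⟨d, hd⟩ : ∃ d, S.card = k + 3 + d := ⟨S.card - (k + 3), by omega⟩
  set s := S.orderEmbOfFin hd with hs
  have hmem : ∀ i, s i ∈ S := fun i => Finset.orderEmbOfFin_mem S hd i
  have hsum : ∀ g : Fin (k + 1) → Fin (k + 3 + d), Function.Injective g → ∑ i, s (g i) ∈ S := by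
    intro g hg
    have hinj : Function.Injective fun i => s (g i) := s.injective.comp hg
    have := hS (Finset.univ.image fun i => s (g i))
      (by intro x hx; obtain ⟨i, -, rfl⟩ := Finset.mem_image.1 hx; exact hmem _)
      (by rw [Finset.card_image_of_injective _ hinj]; simp)
    rwa [Finset.sum_image (fun _ _ _ _ h => hinj h)] at this
  have hrange : ∀ x ∈ S, ∃ i, s i = x := by
    intro x hx
    have : x ∈ Set.range s := by rw [hs, Finset.range_orderEmbOfFin]; exact hx
    exact this
  -- top
  have htop := hsum (fun i => ⟨i + 2 + d, by omega⟩) (by intro a b h; simp at h; omega)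
  have hbot := hsum (fun i => ⟨i, by omega⟩) (by intro a b h; simp at h; omega)
  rw [Fin.sum_univ_castSucc] at htop
  rw [Fin.sum_univ_succ] at hbot
  obtain ⟨i1, h1⟩ := hrange _ htop
  obtain ⟨i2, h2⟩ := hrange _ hbot
  have h1' : s i1 ≤ s ⟨(Fin.last k : Fin (k+1)) + 2 + d, by simp⟩ :=
    s.monotone (by rw [Fin.le_def]; have := i1.2; simp only [Fin.val_last]; omega)
  have h2' : s ⟨(0 : Fin (k+1)), by simp⟩ ≤ s i2 :=
    s.monotone (by rw [Fin.le_def]; simp)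
  have hlt : ∑ i : Fin k, s ⟨i.succ, by have := i.2; simp only [Fin.val_succ]; omega⟩ <
      ∑ i : Fin k, s ⟨i.castSucc + 2 + d, by simp⟩ := by
    apply Finset.sum_lt_sum_of_nonempty
    · exact ⟨⟨0, by omega⟩, Finset.mem_univ _⟩
    · intro i _
      apply s.strictMono
      rw [Fin.lt_def]; simp; omega
  linarith

theorem mem_A_iff (S : Finset ℤ) (v : ℤ →₀ Kpq) :
    v ∈ Submodule.span Kpq ((fun i : ℤ => Finsupp.single i (1 : Kpq)) '' ↑S) ↔ v.support ⊆ S := by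
  rw [← Finsupp.supported_eq_span_single, Finsupp.mem_supported]
  norm_cast

theorem card_ne_succ (n : ℕ) (hn : 3 ≤ n) (h0 : 0 < n) (S : Finset ℤ)
    (hS : ∀ T ⊆ S, T.card = n → ∑ x ∈ T, x ∈ S)
    (hFI : ∀ Y X : Fin n → ℤ, (∀ j, Y j ∈ S) → (∀ j, X j ∈ S) →
      holdsFI pVar qVar n h0 (fun j => Finsupp.single (Y j) 1)
        (fun j => Finsupp.single (X j) 1)) : S.card ≠ n + 1 := by
  intro hcard
  set σ := ∑ x ∈ S, x with hσ
  have hrefl : ∀ x ∈ S, σ - x ∈ S := by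
    intro x hx
    have := hS (S.erase x) (Finset.erase_subset _ _) (by rw [Finset.card_erase_of_mem hx]; omega)
    rw [← Finset.sum_erase_add _ _ hx] at hσ
    rw [hσ]; simpa using this
  have hσ0 : σ = 0 := by
    have h : ∑ x ∈ S, x = ∑ x ∈ S, (σ - x) :=
      Finset.sum_nbij' (fun x => σ - x) (fun x => σ - x) hrefl hrefl (by simp) (by simp) (by simp)
    rw [Finset.sum_sub_distrib, Finset.sum_const, hcard, ← hσ] at h
    simp only [nsmul_eq_mul] at h
    push_cast at h
    have h' : ((n : ℤ) - 1) * σ = 0 := by linear_combination -h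
    rcases mul_eq_zero.1 h' with h'' | h''
    · omega
    · exact h''
  have hneg : ∀ x ∈ S, -x ∈ S := by
    intro x hx; have := hrefl x hx; rwa [hσ0, zero_sub] at this
  obtain ⟨k, rfl⟩ : ∃ k, n = k + 1 := ⟨n - 1, by omega⟩
  obtain ⟨a, haS, ha0⟩ : ∃ a ∈ S, a ≠ 0 := by
    obtain ⟨a, ha, h⟩ := Finset.exists_mem_ne (s := S) (by omega) 0
    exact ⟨a, ha, h⟩
  set T := (S.erase a).erase (-a) with hT
  have hna : -a ∈ S.erase a := Finset.mem_erase.2 ⟨by omega, hneg a haS⟩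
  have hTcard : T.card = k := by
    rw [hT, Finset.card_erase_of_mem hna, Finset.card_erase_of_mem haS]; omega
  have hTneg : ∀ x ∈ T, -x ∈ T := by
    intro x hx
    simp only [hT, Finset.mem_erase] at hx ⊢
    exact ⟨by omega, by omega, hneg x hx.2.2⟩
  have haT : a ∉ T := by simp [hT]
  have hTS : T ⊆ S := (Finset.erase_subset _ _).trans (Finset.erase_subset _ _)
  obtain ⟨s, hsT⟩ : T.Nonempty := Finset.card_pos.1 (by omega)
  have hUcard : (S.erase s).card = k + 1 := by
    rw [Finset.card_erase_of_mem (hTS hsT)]; omega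
  set y : Fin k → ℤ := fun i => T.orderEmbOfFin hTcard i with hy
  set X : Fin (k + 1) → ℤ := fun i => (S.erase s).orderEmbOfFin hUcard i with hX
  have hyinj : Function.Injective y := (T.orderEmbOfFin hTcard).injective
  have hXinj : Function.Injective X := ((S.erase s).orderEmbOfFin hUcard).injective
  have hyT : Finset.univ.image y = T := Finset.image_orderEmbOfFin_univ T hTcard
  have hXU : Finset.univ.image X = S.erase s := Finset.image_orderEmbOfFin_univ _ hUcard
  have hysum : ∑ i, y i = 0 := by
    have h : ∑ x ∈ T, x = ∑ x ∈ T, -x :=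
      Finset.sum_nbij' (fun x => -x) (fun x => -x) hTneg hTneg (by simp) (by simp) (by simp)
    rw [Finset.sum_neg_distrib] at h
    have h2 : ∑ i, y i = ∑ x ∈ T, x := by
      rw [← hyT, Finset.sum_image (fun _ _ _ _ h => hyinj h)]
    omega
  have hXsum : ∑ i, X i = -s := by
    have h2 : ∑ i, X i = ∑ x ∈ S.erase s, x := by
      rw [← hXU, Finset.sum_image (fun _ _ _ _ h => hXinj h)]
    have := Finset.sum_erase_add S (fun x => x) (hTS hsT)
    omega
  have hF := hFI (Fin.snoc (α := fun _ => ℤ) y a) X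
    (by
      intro j
      refine Fin.lastCases ?_ (fun i => ?_) j
      · simpa using haS
      · simpa using hTS (Finset.orderEmbOfFin_mem T hTcard i))
    (fun j => Finset.mem_of_mem_erase (Finset.orderEmbOfFin_mem _ hUcard j))
  have hc : ∀ x : ℤ, x ∈ T → vwC pVar qVar (k+1) (Fin.snoc (α := fun _ => ℤ) y x) = 0 := by
    intro x hx
    by_contra h
    have hinj := (vwC_ne_zero_iff _ _ pVar_ne qVar_ne pq_inj _ _).1 h
    rw [← hyT] at hx
    obtain ⟨i, -, hi⟩ := Finset.mem_image.1 hx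
    have := hinj (a₁ := i.castSucc) (a₂ := Fin.last k) (by simpa using hi)
    exact (Fin.castSucc_lt_last i).ne this
  have hlast : ∀ (x : ℤ) (c : Kpq), Function.update
      (fun j => Finsupp.single ((Fin.snoc (α := fun _ => ℤ) y a : Fin (k+1) → ℤ) j) (1 : Kpq))
        (Fin.last k) (Finsupp.single x c) =
      fun j => Finsupp.single ((Fin.snoc (α := fun _ => ℤ) y x : Fin (k+1) → ℤ) j)
        ((Fin.snoc (α := fun _ => Kpq) (fun _ => 1) c : Fin (k+1) → Kpq) j) := by
    intro x c
    ext1 j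
    refine Fin.lastCases ?_ (fun i => ?_) j
    · simp
    · simp [(Fin.castSucc_lt_last i).ne]
  have hbr : ∀ (x : ℤ) (c : Kpq), vwBr pVar qVar (k + 1) (Function.update
      (fun j => Finsupp.single ((Fin.snoc (α := fun _ => ℤ) y a : Fin (k+1) → ℤ) j) (1 : Kpq))
        (Fin.last k) (Finsupp.single x c)) =
      Finsupp.single x (c * vwC pVar qVar (k + 1) (Fin.snoc (α := fun _ => ℤ) y x)) := by
    intro x c
    rw [hlast, vwBr_single]
    simp [Fin.sum_univ_castSucc, Fin.prod_univ_castSucc, hysum]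
  unfold holdsFI at hF
  change vwBr pVar qVar (k+1) (Function.update _ (Fin.last k) _) = ∑ i, vwBr pVar qVar (k+1)
    (Function.update _ i (vwBr pVar qVar (k+1) (Function.update _ (Fin.last k) _))) at hF
  rw [vwBr_single, hXsum, hbr, hc (-s) (hTneg s hsT)] at hF
  simp only [hbr, mul_zero, Finsupp.single_zero, one_mul] at hF
  have hterm : ∀ (i : Fin (k+1)) (c : Kpq), vwBr pVar qVar (k+1) (Function.update
      (fun j => Finsupp.single (X j) (1 : Kpq)) i (Finsupp.single (X i) c)) =
      Finsupp.single (-s) (c * vwC pVar qVar (k+1) X) := by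
    intro i c
    have : Function.update (fun j => Finsupp.single (X j) (1 : Kpq)) i (Finsupp.single (X i) c) =
        fun j => Finsupp.single (X j) (Function.update (fun _ => (1 : Kpq)) i c j) := by
      ext1 j
      by_cases h : j = i
      · subst h; simp
      · simp [h]
    rw [this, vwBr_single, hXsum, Finset.prod_update_of_mem (Finset.mem_univ i)]
    simp
  simp only [hterm] at hF
  rw [← Finsupp.single_finsetSum, ← Finset.sum_mul] at hF
  have hF2 := (Finsupp.single_eq_zero.1 hF.symm)
  have hX0 := (vwC_ne_zero_iff _ _ pVar_ne qVar_ne pq_inj _ _).2 hXinj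
  have hF3 := (mul_eq_zero.1 hF2).resolve_right hX0
  have hF4 : ∑ x ∈ S.erase s, vwC pVar qVar (k+1) (Fin.snoc (α := fun _ => ℤ) y x) = 0 := by
    rw [← hXU, Finset.sum_image (fun _ _ _ _ h => hXinj h)]; exact hF3
  have hsub : ({a, -a} : Finset ℤ) ⊆ S.erase s := by
    simp only [hT, Finset.mem_erase] at hsT
    intro x hx
    simp only [Finset.mem_insert, Finset.mem_singleton] at hx
    rcases hx with rfl | rfl
    · exact Finset.mem_erase.2 ⟨fun h => hsT.2.1 h.symm, haS⟩
    · exact Finset.mem_erase.2 ⟨fun h => hsT.1 h.symm, hneg a haS⟩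
  rw [← Finset.sum_subset hsub, Finset.sum_pair (by omega)] at hF4
  · exact vwC_add_ne_zero pVar qVar pVar_ne qVar_ne pq_inj k T hTcard hTneg y hyinj hyT a ha0 haT hF4
  · intro x hx hx2
    apply hc
    simp only [Finset.mem_insert, Finset.mem_singleton, not_or] at hx2
    exact Finset.mem_erase.2 ⟨hx2.2, Finset.mem_erase.2 ⟨hx2.1, Finset.mem_of_mem_erase hx⟩⟩

/-- **Corollary 8.** Let `n ≥ 3`, `K = ℚ(p,q)`, `S ⊆ ℤ` finite such
that the span `A` of `{e_i : i ∈ S}` is closed under the `(p,q)`-deformed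
Virasoro–Witt `n`-bracket, satisfies the Filippov fundamental identity on `A`, and the
bracket does not vanish identically on `A`. Then `A` is not a simple `n`-Lie algebra:
`I = K·e_σ`, `σ = Σ_{i∈S} i`, is a nonzero proper ideal of `A`, i.e.
`[a₁,…,a_{n−1},x] ∈ I` for all `a₁,…,a_{n−1} ∈ A` and `x ∈ I`. -/
theorem finite_n_Lie_subalgebra_not_simple
    (n : ℕ) (hn : 3 ≤ n) (S : Finset ℤ)
    (A : Submodule Kpq (ℤ →₀ Kpq))
    (hA : A = Submodule.span Kpq ((fun i : ℤ => Finsupp.single i (1 : Kpq)) '' ↑S))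
    (hclosed : ∀ v : Fin n → (ℤ →₀ Kpq), (∀ j, v j ∈ A) → vwBr pVar qVar n v ∈ A)
    (hFI : ∀ Y X : Fin n → (ℤ →₀ Kpq), (∀ j, Y j ∈ A) → (∀ j, X j ∈ A) →
      holdsFI pVar qVar n (by omega) Y X)
    (hnonzero : ∃ v : Fin n → (ℤ →₀ Kpq), (∀ j, v j ∈ A) ∧ vwBr pVar qVar n v ≠ 0) :
    let I : Submodule Kpq (ℤ →₀ Kpq) :=
      Submodule.span Kpq {Finsupp.single (∑ i ∈ S, i) (1 : Kpq)}
    I ≠ ⊥ ∧ I ≤ A ∧ I ≠ A ∧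
      ∀ a : Fin n → (ℤ →₀ Kpq), (∀ j, a j ∈ A) → ∀ x ∈ I,
        vwBr pVar qVar n (Function.update a ⟨n - 1, by omega⟩ x) ∈ I := by
  intro I
  have hmemA : ∀ v : ℤ →₀ Kpq, v ∈ A ↔ v.support ⊆ S := fun v => by rw [hA]; exact mem_A_iff S v
  have hsingle : ∀ i ∈ S, Finsupp.single i (1 : Kpq) ∈ A := by
    intro i hi
    rw [hA]; exact Submodule.subset_span ⟨i, hi, rfl⟩
  have hS : ∀ T ⊆ S, T.card = n → ∑ x ∈ T, x ∈ S := by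
    intro T hTS hTn
    have h := hclosed (fun j => Finsupp.single (T.orderEmbOfFin hTn j) 1)
      (fun j => hsingle _ (hTS (Finset.orderEmbOfFin_mem T hTn j)))
    have hne := (vwC_ne_zero_iff _ _ pVar_ne qVar_ne pq_inj _ _).2 (T.orderEmbOfFin hTn).injective
    have hsum : ∑ j, T.orderEmbOfFin hTn j = ∑ x ∈ T, x := by
      conv_rhs => rw [← Finset.image_orderEmbOfFin_univ T hTn]
      rw [Finset.sum_image (fun _ _ _ _ h => (T.orderEmbOfFin hTn).injective h)]
    rw [vwBr_single, hmemA, hsum, Finset.prod_const_one, one_mul,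
      Finsupp.support_single _ hne] at h
    exact h (Finset.mem_singleton_self _)
  have himg : ∀ f : Fin n → ℤ, (∀ j, f j ∈ S) → Finset.univ.image f ⊆ S := by
    intro f hf x hx
    obtain ⟨j, -, rfl⟩ := Finset.mem_image.1 hx
    exact hf j
  have hge : n ≤ S.card := by
    obtain ⟨v, hv, hne⟩ := hnonzero
    by_contra hlt
    apply hne
    unfold vwBr
    apply Finset.sum_eq_zero
    intro f hf
    rw [Fintype.mem_piFinset] at hf
    have : vwC pVar qVar n f = 0 := by
      by_contra h
      have hinj := (vwC_ne_zero_iff _ _ pVar_ne qVar_ne pq_inj _ _).1 h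
      have := Finset.card_le_card (himg f fun j => (hmemA _).1 (hv j) (hf j))
      rw [Finset.card_image_of_injective _ hinj] at this
      simp at this
      omega
    simp [this]
  have hle := card_le_of_sums n hn S hS
  have hne := card_ne_succ n hn (by omega) S hS fun Y X hY hX =>
    hFI _ _ (fun j => hsingle _ (hY j)) (fun j => hsingle _ (hX j))
  have hcard : S.card = n := by omega
  have hσ : ∑ i ∈ S, i ∈ S := hS S (Finset.Subset.refl _) hcard
  have hIA : I ≤ A := by
    rw [Submodule.span_singleton_le_iff_mem]
    exact hsingle _ hσ
  refine ⟨?_, hIA, ?_, ?_⟩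
  · rw [Ne, Submodule.span_singleton_eq_bot]
    simp
  · intro hEq
    obtain ⟨b, hb, hbne⟩ := Finset.exists_mem_ne (s := S) (by omega) (∑ i ∈ S, i)
    have hbA := hsingle b hb
    rw [← hEq] at hbA
    obtain ⟨c, hc⟩ := Submodule.mem_span_singleton.1 hbA
    have := DFunLike.congr_fun hc b
    simp [Finsupp.single_apply, hbne.symm] at this
  · intro a ha x hx
    have hv : ∀ j, Function.update a ⟨n - 1, by omega⟩ x j ∈ A := by
      intro j
      by_cases h : j = ⟨n - 1, by omega⟩
      · subst h; simpa using hIA hx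
      · simpa [h] using ha j
    unfold vwBr
    apply Submodule.sum_mem
    intro f hf
    rw [Fintype.mem_piFinset] at hf
    by_cases h : vwC pVar qVar n f = 0
    · simp [h]
    · have hinj := (vwC_ne_zero_iff _ _ pVar_ne qVar_ne pq_inj _ _).1 h
      have hsub := himg f fun j => (hmemA _).1 (hv j) (hf j)
      have heq : Finset.univ.image f = S := Finset.eq_of_subset_of_card_le hsub (by
        rw [Finset.card_image_of_injective _ hinj]; simp [hcard])
      have hsum : ∑ j, f j = ∑ i ∈ S, i := by
        rw [← heq, Finset.sum_image (fun _ _ _ _ h => hinj h)]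
      rw [hsum]
      exact Submodule.smul_mem _ _ (Submodule.mem_span_singleton_self _)
end
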